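/- For each k > 0 there exists L > 0 such that every C²-smooth Jordan curve C with curvature κ ≥ k/length(C) at every point is an L-chord-arc curve; that is, for any two points a, b ∈ C, the shorter arc of C joining a and b satisfies length(C|[a,b]) ≤ L⁻¹·... equivalently |a−b| ≥ L·length(C|[a,b]) for L = min{cos(π/2−δ), k/(16π)} with δ = min{k²/(32π), π/4} (after normalizing length(C)=1). In particular the chord-arc constant depends only on k. -/

import Mathlib

open Complex in
/-- Two continuous logarithms of the same function on the line differ by a constant. -/
theorem sub_eq_sub_of_exp_eq {u v : ℝ → ℂ} (hu : Continuous u) (hv : Continuous v)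
    (h : ∀ x, exp (u x) = exp (v x)) (x y : ℝ) : u x - v x = u y - v y := by
  let f : C(ℝ, {z : ℂ // z ≠ 0}) := ⟨fun t ↦ ⟨exp (u t), exp_ne_zero _⟩, by fun_prop⟩
  have key := (isCoveringMap_exp.existsUnique_continuousMap_lifts f y (u y) rfl).unique
    (y₁ := ⟨u, hu⟩) (y₂ := ⟨fun t ↦ v t + (u y - v y), by fun_prop⟩) ⟨rfl, rfl⟩
    ⟨by simp, by
      funext t
      apply Subtype.ext
      change exp (v t + (u y - v y)) = exp (u t)
      rw [exp_add, exp_sub, h y, div_self (exp_ne_zero _), mul_one, h t]⟩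
  have := congrArg (fun F : C(ℝ, ℂ) ↦ F x) key
  simp only [ContinuousMap.coe_mk] at this
  rw [this]; ring

open Complex in
/-- A nowhere vanishing continuous function on the plane has a continuous logarithm. -/
theorem exists_continuous_log {G : ℝ × ℝ → ℂ} (hG : Continuous G) (h0 : ∀ p, G p ≠ 0) :
    ∃ Φ : ℝ × ℝ → ℂ, Continuous Φ ∧ ∀ p, exp (Φ p) = G p := by
  let f : C(ℝ × ℝ, {z : ℂ // z ≠ 0}) := ⟨fun t ↦ ⟨G t, h0 t⟩, by fun_prop⟩
  obtain ⟨F, ⟨-, hF⟩, -⟩ := isCoveringMap_exp.existsUnique_continuousMap_lifts f (0, 0)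
    (log (G (0, 0))) (Subtype.ext (exp_log (h0 _)))
  exact ⟨F, F.continuous, fun p ↦ congrArg Subtype.val (congrFun hF p)⟩

open Complex in
/-- A unit-vector-valued `C¹` function has a `C¹` angle function. -/
theorem exists_angle {T : ℝ → ℂ} (hT : ContDiff ℝ 1 T) (hn : ∀ t, ‖T t‖ = 1) :
    ∃ θ κ : ℝ → ℝ, Continuous κ ∧ (∀ t, HasDerivAt θ (κ t) t) ∧
      ∀ t, T t = exp (θ t * I) := by
  have hT0 : ∀ t, T t ≠ 0 := fun t h ↦ by simpa [h] using hn t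
  have hd : ∀ t, HasDerivAt T (deriv T t) t :=
    fun t ↦ (hT.differentiable (by norm_num) t).hasDerivAt
  have hc : Continuous fun t ↦ deriv T t / T t :=
    (hT.continuous_deriv (by norm_num)).div hT.continuous hT0
  set Λ : ℝ → ℂ := fun s ↦ log (T 0) + ∫ t in (0 : ℝ)..s, deriv T t / T t with hΛ
  have hΛd : ∀ s, HasDerivAt Λ (deriv T s / T s) s := fun s ↦
    (intervalIntegral.integral_hasDerivAt_right (hc.intervalIntegrable _ _)
      (hc.stronglyMeasurableAtFilter _ _) hc.continuousAt).const_add _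
  have hexp : ∀ s, T s = exp (Λ s) := by
    intro s
    have hq : ∀ t, HasDerivAt (fun t ↦ T t * exp (-Λ t)) 0 t := by
      intro t
      convert! (hd t).mul (hΛd t).neg.cexp using 1
      field_simp [hT0 t]
      ring
    have h1 := is_const_of_deriv_eq_zero (fun t ↦ (hq t).differentiableAt)
      (fun t ↦ (hq t).deriv) s 0
    have h2 : Λ 0 = log (T 0) := by simp [hΛ]
    simp only [h2, exp_neg, exp_log (hT0 0), mul_inv_cancel₀ (hT0 0)] at h1
    field_simp at h1
    exact h1
  have hre : ∀ s, (Λ s).re = 0 := by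
    intro s
    have := hn s
    rwa [hexp, norm_exp, Real.exp_eq_one_iff] at this
  refine ⟨fun s ↦ (Λ s).im, fun s ↦ (deriv T s / T s).im, continuous_im.comp hc, ?_, ?_⟩
  · intro t
    exact (imCLM.hasFDerivAt.comp_hasDerivAt t (hΛd t))
  · intro t
    rw [hexp]
    congr 1
    apply Complex.ext <;> simp [hre]

/-- An injective closed curve of period one has no self-intersections at lags in `(0, 1)`. -/
theorem Function.Periodic.apply_add_ne_of_injOn {γ : ℝ → ℂ} (hp : Function.Periodic γ 1)
    (hi : Set.InjOn γ (Set.Ico 0 1)) {d : ℝ} (hd0 : 0 < d) (hd1 : d < 1) (s : ℝ) :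
    γ (s + d) ≠ γ s := by
  have hf : ∀ x, γ (Int.fract x) = γ x := fun x ↦ by
    have := hp.sub_zsmul_eq (x := x) ⌊x⌋
    rwa [zsmul_one] at this
  intro h
  rw [← hf, ← hf s] at h
  have h2 := hi ⟨Int.fract_nonneg _, Int.fract_lt_one _⟩ ⟨Int.fract_nonneg _, Int.fract_lt_one _⟩ h
  obtain ⟨z, hz⟩ := Int.fract_eq_fract.1 h2
  have hz' : d = z := by linarith
  rw [hz'] at hd0 hd1
  have h3 : 0 < z := by exact_mod_cast hd0
  have h4 : z < 1 := by exact_mod_cast hd1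
  omega

open Complex in
/-- Chord of a curve with velocity `exp (i θ)`, divided by the parameter difference. -/
noncomputable def meanVelocity (θ : ℝ → ℝ) (s d : ℝ) : ℂ :=
  ∫ u in (0 : ℝ)..1, exp (θ (s + u * d) * I)

open Complex in
theorem continuous_meanVelocity {θ : ℝ → ℝ} (hθ : Continuous θ) :
    Continuous fun p : ℝ × ℝ ↦ meanVelocity θ p.1 p.2 := by
  unfold meanVelocity
  apply intervalIntegral.continuous_parametric_intervalIntegral_of_continuous'
  unfold Function.uncurry
  fun_prop

open Complex in
theorem mul_meanVelocity {θ : ℝ → ℝ} {γ : ℝ → ℂ} (hθ : Continuous θ)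
    (hγ : ∀ t, HasDerivAt γ (exp (θ t * I)) t) (s d : ℝ) :
    d * meanVelocity θ s d = γ (s + d) - γ s := by
  have hderiv : ∀ u ∈ Set.uIcc (0 : ℝ) 1,
      HasDerivAt (fun u : ℝ ↦ γ (s + u * d)) (d * exp (θ (s + u * d) * I)) u := by
    intro u _
    have h1 : HasDerivAt (fun u : ℝ ↦ s + u * d) d u := by
      simpa using ((hasDerivAt_id u).mul_const d).const_add s
    convert! (hγ (s + u * d)).scomp u h1 using 1
  have := intervalIntegral.integral_eq_sub_of_hasDerivAt hderiv
    (Continuous.intervalIntegrable (by fun_prop) _ _)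
  rw [intervalIntegral.integral_const_mul] at this
  simpa [meanVelocity] using this

open Complex in
/-- The tangent of a positively turning simple closed curve makes exactly one full turn. -/
theorem angle_add_one_eq {θ : ℝ → ℝ} {γ : ℝ → ℂ} (hθ : Continuous θ) (hmono : StrictMono θ)
    (hγ : ∀ t, HasDerivAt γ (exp (θ t * I)) t) (hp : Function.Periodic γ 1)
    (hi : Set.InjOn γ (Set.Ico 0 1)) (s : ℝ) : θ (s + 1) = θ s + 2 * Real.pi := by
  have hγc : Continuous γ := continuous_iff_continuousAt.2 fun t ↦ (hγ t).continuousAt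
  -- a lowest point of the curve
  obtain ⟨s₀, hs₀⟩ : ∃ s₀, ∀ t, (γ s₀).im ≤ (γ t).im := by
    obtain ⟨s₀, -, h⟩ := (isCompact_Icc (a := (0 : ℝ)) (b := 1)).exists_isMinOn
      ⟨0, by simp⟩ (continuous_im.comp hγc).continuousOn
    refine ⟨s₀, fun t ↦ ?_⟩
    obtain ⟨y, hy, hty⟩ := hp.exists_mem_Ico₀ one_pos t
    rw [hty]
    exact h ⟨hy.1, hy.2.le⟩
  -- the secant direction `(γ (s + d) - γ s) / (d (1 - d))`, extended continuously to `d = 0, 1`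
  set G : ℝ → ℝ → ℂ := fun s d ↦ meanVelocity θ s d - meanVelocity θ (s + d) (1 - d) with hG
  have hmv := continuous_meanVelocity hθ
  have hGmul : ∀ s d : ℝ, ((d * (1 - d) : ℝ) : ℂ) * G s d = γ (s + d) - γ s := by
    intro s d
    have h1 := mul_meanVelocity hθ hγ s d
    have h2 := mul_meanVelocity hθ hγ (s + d) (1 - d)
    rw [show s + d + (1 - d) = s + 1 by ring, hp s] at h2
    push_cast at h2 ⊢
    simp only [hG]
    linear_combination (1 - d : ℂ) * h1 - (d : ℂ) * h2
  have hmv0 : ∀ s, meanVelocity θ s 0 = exp (θ s * I) := fun s ↦ by simp [meanVelocity]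
  have hmv1 : ∀ s, meanVelocity θ s 1 = 0 := fun s ↦ by
    simpa [hp s] using mul_meanVelocity hθ hγ s 1
  have hG0 : ∀ s, G s 0 = exp (θ s * I) := fun s ↦ by simp [hG, hmv0, hmv1]
  have hper : ∀ s, exp (θ (s + 1) * I) = exp (θ s * I) := fun s ↦ by
    have h1 := (hγ (s + 1)).comp_add_const s 1
    rw [show (fun x ↦ γ (x + 1)) = γ from funext hp] at h1
    exact h1.unique (hγ s)
  have hmvper : ∀ s d, meanVelocity θ (s + 1) d = meanVelocity θ s d := fun s d ↦ by
    unfold meanVelocity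
    congr 1
    funext u
    rw [show s + 1 + u * d = s + u * d + 1 by ring, hper]
  have hGsymm : ∀ s d, G (s + d) (1 - d) = -G s d := fun s d ↦ by
    simp only [hG]
    rw [show s + d + (1 - d) = s + 1 by ring, hmvper]
    ring_nf
  have hGne : ∀ s d, 0 ≤ d → d ≤ 1 → G s d ≠ 0 := by
    intro s d hd0 hd1
    rcases hd0.eq_or_lt with rfl | hd0
    · rw [hG0]; exact exp_ne_zero _
    rcases hd1.eq_or_lt with rfl | hd1
    · have := hGsymm s 1
      rw [sub_self, hG0] at this
      intro h
      rw [h, neg_zero] at this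
      exact exp_ne_zero _ this
    intro h
    have := hGmul s d
    rw [h, mul_zero] at this
    exact hp.apply_add_ne_of_injOn hi hd0 hd1 s (sub_eq_zero.1 this.symm)
  -- a continuous logarithm of the secant direction
  set cl : ℝ → ℝ := fun d ↦ max 0 (min d 1) with hcl
  have hclc : Continuous cl := by fun_prop
  have hcl0 : ∀ d, 0 ≤ cl d := fun d ↦ le_max_left _ _
  have hcl1 : ∀ d, cl d ≤ 1 := fun d ↦ max_le zero_le_one (min_le_right _ _)
  have hclid : ∀ d, 0 ≤ d → d ≤ 1 → cl d = d := fun d h0 h1 ↦ by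
    simp [hcl, h0, h1]
  have hGc : Continuous fun p : ℝ × ℝ ↦ G p.1 p.2 :=
    hmv.sub (hmv.comp (f := fun p : ℝ × ℝ ↦ (p.1 + p.2, 1 - p.2)) (by fun_prop))
  obtain ⟨Φ, hΦc, hΦ⟩ := exists_continuous_log (G := fun p ↦ G p.1 (cl p.2))
    (hGc.comp (f := fun p : ℝ × ℝ ↦ (p.1, cl p.2)) (by fun_prop))
    (fun p ↦ hGne _ _ (hcl0 _) (hcl1 _))
  set c : ℂ := Φ (s₀, 1) - Φ (s₀, 0) with hc
  have hexpc : exp c = -1 := by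
    have h := hGsymm s₀ 0
    have h1 := hGsymm s₀ 1
    rw [sub_self, hG0, hper] at h1
    rw [hc, exp_sub, hΦ, hΦ]
    simp only [hclid 1 zero_le_one le_rfl, hclid 0 le_rfl zero_le_one]
    rw [hG0, show G s₀ 1 = -exp (θ s₀ * I) by rw [h1, neg_neg], neg_div,
      div_self (exp_ne_zero _)]
  have hturn : Φ (s₀ + 1, 0) - Φ (s₀, 0) = 2 * c := by
    have h := sub_eq_sub_of_exp_eq (u := fun x ↦ Φ (s₀ + cl x, 1 - cl x))
      (v := fun x ↦ Φ (s₀, cl x) + c) (by fun_prop) (by fun_prop) (fun x ↦ by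
        rw [exp_add, hexpc, hΦ, hΦ]
        simp only [hclid _ (hcl0 x) (hcl1 x),
          hclid (1 - cl x) (by linarith [hcl1 x]) (by linarith [hcl0 x]), hGsymm]
        ring) 0 1
    simp only [hclid 1 zero_le_one le_rfl, hclid 0 le_rfl zero_le_one, add_zero, sub_zero,
      sub_self] at h
    rw [hc] at h ⊢
    linear_combination -h
  have hΦθ : ∀ x y, Φ (x, 0) - θ x * I = Φ (y, 0) - θ y * I :=
    sub_eq_sub_of_exp_eq (by fun_prop) (by fun_prop) fun x ↦ by
      rw [hΦ]
      simp only [hclid 0 le_rfl zero_le_one, hG0]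
  have hθc : θ (s₀ + 1) - θ s₀ = 2 * c.im := by
    have h := congrArg im (hturn.symm.trans
      (show _ = ((θ (s₀ + 1) - θ s₀ : ℝ) : ℂ) * I by
        push_cast; linear_combination hΦθ (s₀ + 1) s₀))
    simpa using h.symm
  have hcpos : 0 < c.im := by
    have := hmono (show s₀ < s₀ + 1 by linarith)
    linarith
  -- seen from the lowest point, the curve stays above, so the secant cannot turn by `2π`
  have hclt : c.im ≤ 2 * Real.pi := by
    by_contra! hlt
    obtain ⟨n, hn1, hn2⟩ : ∃ n : ℤ, (Φ (s₀, 0)).im < -(Real.pi / 2) + n * (2 * Real.pi) ∧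
        -(Real.pi / 2) + n * (2 * Real.pi) < (Φ (s₀, 1)).im := by
      have hpi := Real.two_pi_pos
      set q := ((Φ (s₀, 0)).im + Real.pi / 2) / (2 * Real.pi) with hq
      have hqm : q * (2 * Real.pi) = (Φ (s₀, 0)).im + Real.pi / 2 := by
        rw [hq]; field_simp
      have hci : c.im = (Φ (s₀, 1)).im - (Φ (s₀, 0)).im := by simp [hc]
      refine ⟨⌊q⌋ + 1, ?_, ?_⟩ <;> push_cast
      · nlinarith [Int.lt_floor_add_one q]
      · nlinarith [Int.floor_le q]
    obtain ⟨d, hd, hdx⟩ := intermediate_value_Ioo zero_le_one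
      (f := fun d ↦ (Φ (s₀, d)).im) (by fun_prop) ⟨hn1, hn2⟩
    have h1 := congrArg im (hGmul s₀ d)
    rw [im_ofReal_mul, sub_im (γ _) (γ _)] at h1
    have h2 := hs₀ (s₀ + d)
    have h3 : (G s₀ d).im < 0 := by
      have h4 := hΦ (s₀, d)
      simp only [hclid d hd.1.le hd.2.le] at h4
      simp only at hdx
      rw [← h4, exp_im, hdx, Real.sin_add_int_mul_two_pi, Real.sin_neg, Real.sin_pi_div_two]
      simpa using Real.exp_pos _
    have h5 : 0 < d * (1 - d) := mul_pos hd.1 (by linarith [hd.2])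
    nlinarith [mul_pos h5 (neg_pos.2 h3)]
  have hcpi : c.im = Real.pi := by
    obtain ⟨n, hn⟩ := exp_eq_exp_iff_exists_int.1 (hexpc.trans exp_pi_mul_I.symm)
    have h1 : c.im = Real.pi + n * (2 * Real.pi) := by simpa using congrArg im hn
    have hpi := Real.pi_pos
    rw [h1] at hcpos hclt
    have h2 : -1 < n := by
      by_contra! h
      have : (n : ℝ) ≤ -1 := by exact_mod_cast h
      nlinarith
    have h3 : n < 1 := by
      by_contra! h
      have : (1 : ℝ) ≤ n := by exact_mod_cast h
      nlinarith
    have h4 : n = 0 := by omega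
    rw [h1, h4]; simp
  have h := sub_eq_sub_of_exp_eq (u := fun s ↦ θ (s + 1) * I) (v := fun s ↦ θ s * I)
    (by fun_prop) (by fun_prop) hper s s₀
  have := congrArg im h
  simp at this
  linarith

open Complex in
/-- A curve whose velocity has component at least `m` in a fixed direction advances at rate `m`
in this direction. -/
theorem mul_sub_le_re_of_le_cos {θ : ℝ → ℝ} {γ : ℝ → ℂ}
    (hγ : ∀ t, HasDerivAt γ (exp (θ t * I)) t) {a b m ψ : ℝ} (hab : a ≤ b)
    (hm : ∀ t ∈ Set.Icc a b, m ≤ Real.cos (θ t - ψ)) :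
    m * (b - a) ≤ ((γ b - γ a) * exp (-ψ * I)).re := by
  have hd : ∀ t, HasDerivAt (fun t ↦ (γ t * exp (-ψ * I)).re) (Real.cos (θ t - ψ)) t := by
    intro t
    have h := reCLM.hasFDerivAt.comp_hasDerivAt t ((hγ t).mul_const (exp (-ψ * I)))
    convert! h using 1
    rw [← exp_add, show (θ t : ℂ) * I + -ψ * I = ((θ t - ψ : ℝ) : ℂ) * I by push_cast; ring]
    exact (exp_ofReal_mul_I_re _).symm
  have h := (convex_Icc a b).mul_sub_le_image_sub_of_le_deriv
    (fun t _ ↦ (hd t).continuousAt.continuousWithinAt)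
    (fun t _ ↦ (hd t).differentiableAt.differentiableWithinAt)
    (C := m) (fun t ht ↦ by rw [(hd t).deriv]; exact hm t (interior_subset ht))
    a (Set.left_mem_Icc.2 hab) b (Set.right_mem_Icc.2 hab) hab
  rw [sub_mul, sub_re]
  exact h

open Complex in
theorem re_mul_exp_le_norm (z : ℂ) (ψ : ℝ) : (z * exp (-ψ * I)).re ≤ ‖z‖ := by
  refine (re_le_norm _).trans_eq ?_
  rw [norm_mul, ← ofReal_neg, norm_exp_ofReal_mul_I, mul_one]

open Complex in
/-- An arc turning by at most `π - δ` has chord at least `sin (δ / 2)` times its length. -/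
theorem sin_mul_le_norm_sub {θ : ℝ → ℝ} {γ : ℝ → ℂ} (hmono : Monotone θ)
    (hγ : ∀ t, HasDerivAt γ (exp (θ t * I)) t) {a b δ : ℝ} (hab : a ≤ b) (hδ : 0 ≤ δ)
    (hturn : θ b - θ a ≤ Real.pi - δ) :
    Real.sin (δ / 2) * (b - a) ≤ ‖γ b - γ a‖ := by
  refine (mul_sub_le_re_of_le_cos hγ hab (ψ := (θ a + θ b) / 2) fun t ht ↦ ?_).trans
    (re_mul_exp_le_norm _ _)
  have h1 := hmono ht.1
  have h2 := hmono ht.2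
  rw [← Real.cos_pi_div_two_sub, ← Real.cos_abs (θ t - _)]
  exact Real.cos_le_cos_of_nonneg_of_le_pi (abs_nonneg _) (by linarith [Real.pi_pos])
    (abs_le.2 ⟨by linarith, by linarith⟩)

open Complex in
/-- An arc of length at least `1 / 2` turning by barely more than `π` has a long chord. -/
theorem div_le_norm_sub {θ : ℝ → ℝ} {γ : ℝ → ℂ} {k : ℝ} (hk : 0 < k)
    (hθk : ∀ s t, s ≤ t → k * (t - s) ≤ θ t - θ s)
    (hγ : ∀ t, HasDerivAt γ (exp (θ t * I)) t) {a b δ : ℝ} (hab : 1 / 2 ≤ b - a)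
    (hδ0 : 0 ≤ δ) (hδ : δ ≤ k / 64) (hturn : θ b - θ a ≤ Real.pi + δ) :
    k / 256 ≤ ‖γ b - γ a‖ := by
  have hcos : ∀ t, Real.cos (θ t - (θ a + Real.pi / 2)) = Real.sin (θ t - θ a) := fun t ↦ by
    rw [← Real.cos_sub_pi_div_two]; congr 1; ring
  have hlow : ∀ t, a ≤ t → t ≤ b → -δ ≤ Real.cos (θ t - (θ a + Real.pi / 2)) := by
    intro t hat htb
    rw [hcos]
    have h1 := hθk a t hat
    have h2 := hθk t b htb
    have h3 : 0 ≤ k * (t - a) := mul_nonneg hk.le (by linarith)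
    have h4 : 0 ≤ k * (b - t) := mul_nonneg hk.le (by linarith)
    rcases le_or_gt (θ t - θ a) Real.pi with h | h
    · linarith [Real.sin_nonneg_of_nonneg_of_le_pi (by linarith) h]
    · have h5 := Real.sin_le (x := θ t - θ a - Real.pi) (by linarith)
      rw [Real.sin_sub_pi] at h5
      linarith
  have hmid : ∀ t, a + (b - a) / 4 ≤ t → t ≤ b - (b - a) / 4 →
      k / 32 ≤ Real.cos (θ t - (θ a + Real.pi / 2)) := by
    intro t hat htb
    rw [hcos]
    have h1 := hθk a t (by linarith)
    have h2 := hθk t b (by linarith)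
    have h3 : k * (1 / 8) ≤ k * (t - a) := mul_le_mul_of_nonneg_left (by linarith) hk.le
    have h4 : k * (1 / 8) ≤ k * (b - t) := mul_le_mul_of_nonneg_left (by linarith) hk.le
    have hpi : 1 / 2 ≤ 2 / Real.pi := by
      rw [div_le_div_iff₀ two_pos Real.pi_pos]; linarith [Real.pi_le_four]
    have key : ∀ x, k / 16 ≤ x → x ≤ Real.pi / 2 → k / 32 ≤ Real.sin x := by
      intro x hx hx2
      have := Real.mul_le_sin (x := x) (by linarith) hx2
      nlinarith
    rcases le_or_gt (θ t - θ a) (Real.pi / 2) with h | h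
    · exact key _ (by linarith) h
    · rw [← Real.sin_pi_sub]
      exact key _ (by linarith) (by linarith)
  have e1 := mul_sub_le_re_of_le_cos hγ (a := a) (b := a + (b - a) / 4) (by linarith)
    fun t ht ↦ hlow t ht.1 (by linarith [ht.2])
  have e2 := mul_sub_le_re_of_le_cos hγ (a := a + (b - a) / 4) (b := b - (b - a) / 4)
    (by linarith) fun t ht ↦ hmid t ht.1 ht.2
  have e3 := mul_sub_le_re_of_le_cos hγ (a := b - (b - a) / 4) (b := b) (by linarith)
    fun t ht ↦ hlow t (by linarith [ht.1]) ht.2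
  have e4 := re_mul_exp_le_norm (γ b - γ a) (θ a + Real.pi / 2)
  simp only [sub_mul, sub_re] at e1 e2 e3 e4
  nlinarith

open Complex in
/-- Chord-arc estimate for a positively turning simple closed curve of unit speed. -/
theorem chord_arc_of_angle {θ : ℝ → ℝ} {γ : ℝ → ℂ} {k : ℝ} (hk : 0 < k) (hθ : Continuous θ)
    (hθk : ∀ s t, s ≤ t → k * (t - s) ≤ θ t - θ s)
    (hγ : ∀ t, HasDerivAt γ (exp (θ t * I)) t) (hp : Function.Periodic γ 1)
    (hi : Set.InjOn γ (Set.Ico 0 1)) {a b : ℝ} (hab : a ≤ b) (hba : b ≤ a + 1) :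
    min (k / 128) (Real.sin (min (k / 64) 1 / 2)) * min (b - a) (1 - (b - a)) ≤
      ‖γ b - γ a‖ := by
  set δ := min (k / 64) 1 with hδ
  have hδ0 : 0 < δ := lt_min (by linarith) one_pos
  have hδk : δ ≤ k / 64 := min_le_left _ _
  have hδ1 : δ ≤ 1 := min_le_right _ _
  have hsin : 0 < Real.sin (δ / 2) :=
    Real.sin_pos_of_pos_of_lt_pi (by linarith) (by linarith [Real.pi_gt_three])
  have hL : 0 < min (k / 128) (Real.sin (δ / 2)) := lt_min (by linarith) hsin
  have hmono : StrictMono θ := fun s t hst ↦ by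
    have h1 := hθk s t hst.le
    have h2 : 0 < k * (t - s) := mul_pos hk (by linarith)
    linarith
  have hlong : ∀ a b : ℝ, 1 / 2 ≤ b - a → b ≤ a + 1 →
      min (k / 128) (Real.sin (δ / 2)) * (1 - (b - a)) ≤ ‖γ b - γ a‖ := by
    intro a b h1 h2
    rcases le_or_gt (θ b - θ a) (Real.pi + δ) with h | h
    · refine le_trans ?_ (div_le_norm_sub hk hθk hγ h1 hδ0.le hδk h)
      have := mul_le_mul (min_le_left (k / 128) (Real.sin (δ / 2)))
        (show 1 - (b - a) ≤ 1 / 2 by linarith) (by linarith) (by linarith)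
      linarith
    · have hθ1 := angle_add_one_eq hθ hmono hγ hp hi a
      have := sin_mul_le_norm_sub hmono.monotone hγ h2 hδ0.le (by linarith)
      rw [hp a, norm_sub_rev] at this
      refine le_trans ?_ this
      rw [show a + 1 - b = 1 - (b - a) by ring]
      exact mul_le_mul_of_nonneg_right (min_le_right _ _) (by linarith)
  rcases le_or_gt (1 / 2) (b - a) with h | h
  · exact (mul_le_mul_of_nonneg_left (min_le_right _ _) hL.le).trans (hlong a b h hba)
  · have := hlong b (a + 1) (by linarith) (by linarith)
    rw [hp a, norm_sub_rev, show 1 - (a + 1 - b) = b - a by ring] at this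
    exact (mul_le_mul_of_nonneg_left (min_le_left _ _) hL.le).trans this

open Complex in
/-- Chord-arc estimate for a unit-speed simple closed curve whose curvature is at least `k`. -/
theorem chord_arc_of_unit_speed {γ : ℝ → ℂ} {k : ℝ} (hk : 0 < k) (hp : Function.Periodic γ 1)
    (hγ : ContDiff ℝ 2 γ) (hi : Set.InjOn γ (Set.Ico 0 1)) (hn : ∀ t, ‖deriv γ t‖ = 1)
    (hκ : ∀ t, k ≤ ‖deriv (deriv γ) t‖) {a b : ℝ} (hab : a ≤ b) (hba : b ≤ a + 1) :
    min (k / 128) (Real.sin (min (k / 64) 1 / 2)) * min (b - a) (1 - (b - a)) ≤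
      ‖γ b - γ a‖ := by
  have hT : ContDiff ℝ 1 (deriv γ) := ContDiff.deriv' (by rwa [one_add_one_eq_two])
  obtain ⟨θ, κ, hκc, hθ, hexp⟩ := exists_angle hT hn
  have hθc : Continuous θ := continuous_iff_continuousAt.2 fun t ↦ (hθ t).continuousAt
  have hdγ : ∀ t, HasDerivAt γ (exp (θ t * I)) t := fun t ↦ by
    rw [← hexp]; exact (hγ.differentiable (by norm_num) t).hasDerivAt
  have habs : ∀ t, k ≤ |κ t| := by
    intro t
    have h : HasDerivAt (deriv γ) (exp (θ t * I) * (κ t * I)) t := by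
      rw [show deriv γ = fun t ↦ exp (θ t * I) from funext hexp]
      exact ((hθ t).ofReal_comp.mul_const I).cexp
    have := hκ t
    rw [h.deriv, norm_mul, norm_exp_ofReal_mul_I] at this
    simpa using this
  have hgrow : ∀ {φ φ' : ℝ → ℝ}, (∀ t, HasDerivAt φ (φ' t) t) → (∀ t, k ≤ φ' t) →
      ∀ s t, s ≤ t → k * (t - s) ≤ φ t - φ s := fun h h' _ _ hst ↦
    mul_sub_le_image_sub_of_le_deriv (fun t ↦ (h t).differentiableAt)
      (fun t ↦ by rw [(h t).deriv]; exact h' t) hst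
  have hsign : (∀ t, k ≤ κ t) ∨ ∀ t, k ≤ -κ t := by
    by_contra! h
    obtain ⟨⟨x, hx⟩, y, hy⟩ := h
    have hx' : κ x < 0 := by
      rcases le_abs.1 (habs x) with h | h <;> linarith
    have hy' : 0 < κ y := by
      rcases le_abs.1 (habs y) with h | h <;> linarith
    obtain ⟨z, hz⟩ := mem_range_of_exists_le_of_exists_ge hκc ⟨x, hx'.le⟩ ⟨y, hy'.le⟩
    have := habs z
    rw [hz, abs_zero] at this
    linarith
  rcases hsign with h | h
  · exact chord_arc_of_angle hk hθc (hgrow hθ h) hdγ hp hi hab hba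
  · have hconj : ∀ t, HasDerivAt (fun t ↦ starRingEnd ℂ (γ t))
        (exp ((-θ t : ℝ) * I)) t := fun t ↦ by
      convert! conjCLE.toContinuousLinearMap.hasFDerivAt.comp_hasDerivAt t (hdγ t) using 1
      simp [← exp_conj]
    have := chord_arc_of_angle hk hθc.neg (hgrow (fun t ↦ (hθ t).neg) h) hconj
      (fun t ↦ by simp only [hp t]) (fun x hx y hy hxy ↦
        hi hx hy ((starRingEnd ℂ).injective hxy)) hab hba
    rwa [← map_sub, norm_conj] at this

theorem stmt3 (k : ℝ) (hk : 0 < k) :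
    ∃ L > 0, ∀ (γ : ℝ → ℂ) (ℓ : ℝ), 0 < ℓ →
      Function.Periodic γ 1 → ContDiff ℝ 2 γ → Set.InjOn γ (Set.Ico 0 1) →
      -- constant speed parametrization of a curve of length ℓ
      (∀ t, ‖deriv γ t‖ = ℓ) →
      -- curvature κ(t) = ‖γ̈(t)‖/ℓ² bounded below by k/length
      (∀ t, k / ℓ ≤ ‖deriv (deriv γ) t‖ / ℓ ^ 2) →
      -- chord-arc: |a - b| ≥ L · length of the shorter arc joining a and b
      ∀ t1 t2 : ℝ, t1 ∈ Set.Ico (0:ℝ) 1 → t2 ∈ Set.Ico (0:ℝ) 1 →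
        L * (ℓ * min |t1 - t2| (1 - |t1 - t2|)) ≤ dist (γ t1) (γ t2) := by
  refine ⟨min (k / 128) (Real.sin (min (k / 64) 1 / 2)), lt_min (by linarith)
    (Real.sin_pos_of_pos_of_lt_pi ?_ ?_), ?_⟩
  · have : 0 < min (k / 64) 1 := lt_min (by linarith) one_pos
    linarith
  · linarith [min_le_right (k / 64) 1, Real.pi_gt_three]
  intro γ ℓ hℓ hp hγ hi hn hκ t1 t2 ht1 ht2
  wlog hle : t1 ≤ t2 generalizing t1 t2
  · rw [abs_sub_comm, dist_comm]
    exact this t2 t1 ht2 ht1 (le_of_not_ge hle)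
  have hd : deriv (fun t ↦ (ℓ : ℂ)⁻¹ * γ t) = fun t ↦ (ℓ : ℂ)⁻¹ * deriv γ t :=
    funext fun t ↦ deriv_const_mul_field _
  have hdd : deriv (fun t ↦ (ℓ : ℂ)⁻¹ * deriv γ t) = fun t ↦ (ℓ : ℂ)⁻¹ * deriv (deriv γ) t :=
    funext fun t ↦ deriv_const_mul_field _
  have hℓn : ‖(ℓ : ℂ)⁻¹‖ = ℓ⁻¹ := by simp [abs_of_pos hℓ]
  have key := chord_arc_of_unit_speed (γ := fun t ↦ (ℓ : ℂ)⁻¹ * γ t) hk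
    (fun t ↦ by simp only [hp t]) (contDiff_const.mul hγ)
    (fun x hx y hy hxy ↦ hi hx hy
      (mul_left_cancel₀ (inv_ne_zero (Complex.ofReal_ne_zero.2 hℓ.ne')) hxy))
    (fun t ↦ by rw [hd, norm_mul, hℓn, hn, inv_mul_cancel₀ hℓ.ne'])
    (fun t ↦ by
      rw [hd, hdd, norm_mul, hℓn]
      have := hκ t
      rw [div_le_div_iff₀ hℓ (by positivity)] at this
      rw [inv_mul_eq_div, le_div_iff₀ hℓ]
      nlinarith) hle (by linarith [ht1.1, ht2.2])
  rw [← mul_sub, norm_mul, hℓn, inv_mul_eq_div, le_div_iff₀ hℓ] at key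
  rw [abs_sub_comm, abs_of_nonneg (sub_nonneg.2 hle), dist_comm, dist_eq_norm]
  linarith
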